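/- Let f, F_{1,i}, F_{2,i} be twice continuously differentiable, let x̄ ∈ M_c be biactive with SNO-LICQ, and let λ_{1,i}, λ_{2,i} satisfy ∇f(x̄) = Σ_{i=1}^m λ_{1,i}∇F_{1,i}(x̄) + λ_{2,i}∇F_{2,i}(x̄) with λ_{1,i}·λ_{2,i} > 0 for all i (T-stationarity with non-vanishing biactive multipliers). Define the Lagrangian L = f − Σ_{i=1}^m (λ_{1,i}F_{1,i} + λ_{2,i}F_{2,i}) and the tangent space T_{x̄} = {ξ ∈ ℝⁿ : ⟨∇F_{1,i}(x̄), ξ⟩ = 0 and ⟨∇F_{2,i}(x̄), ξ⟩ = 0 for all i}, and assume the Hessian D²L(x̄) restricted to T_{x̄} is nonsingular, i.e., the only ξ ∈ T_{x̄} with ξᵀD²L(x̄)η = 0 for all η ∈ T_{x̄} is ξ = 0. Then x̄ is a local minimizer of f on M_c if and only if λ_{1,i} > 0 and λ_{2,i} > 0 for all i and the quadratic form ξ ↦ ξᵀD²L(x̄)ξ is positive definite on T_{x̄} (i.e., its T-index, the sum of the number of negative eigenvalues of D²L(x̄)|_{T_{x̄}} and the number of indices i with λ_{1,i} < 0 and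 λ_{2,i} < 0, vanishes). -/

import Mathlib

open Filter Topology
open scoped RealInnerProductSpace

noncomputable section

/-- The Lagrange function L = f - Σᵢ (λ₁ᵢ F₁ᵢ + λ₂ᵢ F₂ᵢ). -/
def lagrangian {n m : ℕ} (f : EuclideanSpace ℝ (Fin n) → ℝ)
    (F1 F2 : Fin m → EuclideanSpace ℝ (Fin n) → ℝ) (l1 l2 : Fin m → ℝ) :
    EuclideanSpace ℝ (Fin n) → ℝ :=
  fun y => f y - ∑ i, (l1 i * F1 i y + l2 i * F2 i y)

/-- The tangent space T_x̄ = {ξ : ⟨∇F₁ᵢ(x̄), ξ⟩ = 0, ⟨∇F₂ᵢ(x̄), ξ⟩ = 0 ∀ i}. -/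
def tangentSpace {n m : ℕ} (F1 F2 : Fin m → EuclideanSpace ℝ (Fin n) → ℝ)
    (x : EuclideanSpace ℝ (Fin n)) : Set (EuclideanSpace ℝ (Fin n)) :=
  {ξ | ∀ i, ⟪gradient (F1 i) x, ξ⟫ = 0 ∧ ⟪gradient (F2 i) x, ξ⟫ = 0}

/-- The Hessian of L at x as a bilinear map: ξᵀ D²L(x) η. -/
def hessian {n : ℕ} (L : EuclideanSpace ℝ (Fin n) → ℝ) (x ξ η : EuclideanSpace ℝ (Fin n)) : ℝ :=
  fderiv ℝ (fderiv ℝ L) x ξ η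

section Auxiliary

variable {E F : Type*} [NormedAddCommGroup E] [NormedAddCommGroup F]

/-- Linearly independent vectors admit a vector with prescribed inner products. -/
theorem LinearIndependent.exists_inner_eq [InnerProductSpace ℝ E] [FiniteDimensional ℝ E]
    {ι : Type*} {v : ι → E} (hv : LinearIndependent ℝ v) (w : ι → ℝ) :
    ∃ ξ : E, ∀ i, ⟪v i, ξ⟫ = w i := by
  obtain ⟨φ, hφ⟩ := LinearMap.exists_extend
    ((Finsupp.linearCombination ℝ w).comp hv.repr)
  refine ⟨(InnerProductSpace.toDual ℝ E).symm (LinearMap.toContinuousLinearMap φ), fun i => ?_⟩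
  have hi : v i ∈ Submodule.span ℝ (Set.range v) := Submodule.subset_span ⟨i, rfl⟩
  have h := LinearMap.congr_fun hφ ⟨v i, hi⟩
  rw [real_inner_comm, InnerProductSpace.toDual_symm_apply]
  simpa [hv.repr_eq_single i ⟨v i, hi⟩ rfl] using h

/-- Near a point where `G` has surjective strict derivative `A`, every direction `ξ` is tangent
to a curve along which `G` is affine with slope `A ξ`. -/
theorem HasStrictFDerivAt.exists_curve [NormedSpace ℝ E] [NormedSpace ℝ F] [CompleteSpace E]
    [FiniteDimensional ℝ F] {G : E → F} {A : E →L[ℝ] F} {x : E}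
    (hG : HasStrictFDerivAt G A x) (hA : Function.Surjective A) (ξ : E) :
    ∃ c : ℝ → E, c 0 = x ∧ HasDerivAt c ξ 0 ∧ ∀ᶠ t in 𝓝 (0 : ℝ), G (c t) = G x + t • A ξ := by
  obtain ⟨B, hB⟩ := A.exists_rightInverse_of_surjective (LinearMap.range_eq_top.2 hA)
  have hAB : ∀ z, A (B z) = z := fun z => congrArg (fun T : F →L[ℝ] F => T z) hB
  let Φ : E → E := fun y => (y - x) + B (G y - G x - A (y - x))
  have hAΦ : ∀ y, A (Φ y) = G y - G x := fun y => by simp [Φ, hAB]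
  have hΦx : Φ x = 0 := by simp [Φ]
  have hΦ : HasStrictFDerivAt Φ ((ContinuousLinearEquiv.refl ℝ E : E ≃L[ℝ] E) : E →L[ℝ] E) x := by
    have h1 : HasStrictFDerivAt (fun y : E => y - x) (ContinuousLinearMap.id ℝ E) x :=
      (hasStrictFDerivAt_id x).sub_const x
    have h2 := h1.add (B.hasStrictFDerivAt.comp x
      ((hG.sub_const (G x)).sub (A.hasStrictFDerivAt.comp x h1)))
    refine h2.congr_fderiv ?_
    ext v
    simp
  have hinv := hΦ.to_localInverse
  have hx : hΦ.localInverse Φ _ x 0 = x := by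
    simpa only [hΦx] using hΦ.localInverse_apply_image
  have hr := hΦ.eventually_right_inverse
  rw [hΦx] at hinv hr
  have hline : HasDerivAt (fun t : ℝ => t • ξ) ξ 0 := by
    simpa using (hasDerivAt_id (0 : ℝ)).smul_const ξ
  refine ⟨fun t => hΦ.localInverse Φ _ x (t • ξ), by simp [hx], ?_, ?_⟩
  · have hinv' : HasFDerivAt (hΦ.localInverse Φ _ x)
        ((ContinuousLinearEquiv.refl ℝ E).symm : E →L[ℝ] E) ((0 : ℝ) • ξ) := by
      simpa only [zero_smul] using hinv.hasFDerivAt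
    simpa using! hinv'.comp_hasDerivAt (0 : ℝ) hline
  · have ht : Tendsto (fun t : ℝ => t • ξ) (𝓝 0) (𝓝 0) := by
      simpa using hline.continuousAt.tendsto
    filter_upwards [ht.eventually hr] with t h
    have := hAΦ (hΦ.localInverse Φ _ x (t • ξ))
    rw [h, map_smul] at this
    rw [this]
    abel

/-- Second-order Taylor expansion at a critical point. -/
theorem ContDiff.eventually_abs_sub_le_of_fderiv_eq_zero [NormedSpace ℝ E] {L : E → ℝ}
    (hL : ContDiff ℝ 2 L) {x : E} (hx : fderiv ℝ L x = 0) {ε : ℝ} (hε : 0 < ε) :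
    ∀ᶠ y in 𝓝 x, |L y - L x - 2⁻¹ * fderiv ℝ (fderiv ℝ L) x (y - x) (y - x)|
      ≤ ε * ‖y - x‖ ^ 2 := by
  set H := fderiv ℝ (fderiv ℝ L) x
  have hsymm : ∀ v w, H v w = H w v :=
    (hL.contDiffAt (x := x)).isSymmSndFDerivAt (by simp)
  have hd : HasFDerivAt (fderiv ℝ L) H x :=
    ((hL.fderiv_right (m := 1) (by norm_num)).differentiable (by norm_num) x).hasFDerivAt
  have ho := (hasFDerivAt_iff_isLittleO.1 hd).def hε
  obtain ⟨r, hr, hball⟩ := Metric.eventually_nhds_iff_ball.1 ho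
  filter_upwards [Metric.ball_mem_nhds x hr] with y hy
  have hderiv : ∀ z, HasFDerivAt (fun z => L z - 2⁻¹ * H (z - x) (z - x))
      (fderiv ℝ L z - H (z - x)) z := fun z => by
    have h1 : HasFDerivAt (fun z : E => z - x) (ContinuousLinearMap.id ℝ E) z :=
      (hasFDerivAt_id z).sub_const x
    have h2 := (H.hasFDerivAt.comp z h1).clm_apply h1
    refine (((hL.differentiable (by norm_num)) z).hasFDerivAt.sub
      (h2.const_mul 2⁻¹)).congr_fderiv ?_
    ext v
    have hv : H v (z - x) = H (z - x) v := hsymm v (z - x)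
    simp [-map_sub, hv]
    ring
  have hsub : Metric.closedBall x ‖y - x‖ ⊆ Metric.ball x r :=
    Metric.closedBall_subset_ball (by simpa [dist_eq_norm] using hy)
  have hmv := (convex_closedBall x ‖y - x‖).norm_image_sub_le_of_norm_hasFDerivWithin_le
    (C := ε * ‖y - x‖) (fun z _ => (hderiv z).hasFDerivWithinAt)
    (fun z hz => by
      have := hball z (hsub hz)
      rw [hx, sub_zero] at this
      exact this.trans (mul_le_mul_of_nonneg_left (by simpa [dist_eq_norm] using hz) hε.le))
    (Metric.mem_closedBall_self (norm_nonneg _))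
    (show y ∈ Metric.closedBall x ‖y - x‖ by simp [dist_eq_norm])
  rw [Real.norm_eq_abs] at hmv
  convert! hmv using 1
  · simp only [sub_self, map_zero, mul_zero, sub_zero]
    congr 1
    ring
  · ring

/-- Finsler's lemma: a quadratic form positive definite on `ker A` becomes positive definite on
the whole space after adding a large multiple of `‖A ·‖ ^ 2`. -/
theorem ContinuousLinearMap.exists_mul_norm_sq_le [NormedSpace ℝ E] [NormedSpace ℝ F]
    [FiniteDimensional ℝ E] (H : E →L[ℝ] E →L[ℝ] ℝ) (A : E →L[ℝ] F)
    (hpos : ∀ v, A v = 0 → v ≠ 0 → 0 < H v v) :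
    ∃ K : ℕ, ∃ δ > 0, ∀ v, δ * ‖v‖ ^ 2 ≤ H v v + K * ‖A v‖ ^ 2 := by
  have hcont : ∀ K : ℕ, Continuous fun v => H v v + K * ‖A v‖ ^ 2 := fun K => by fun_prop
  have hS : IsCompact (Metric.sphere (0 : E) 1) := isCompact_sphere 0 1
  obtain ⟨K, hK⟩ := hS.elim_directed_cover (fun K : ℕ => {v | 0 < H v v + K * ‖A v‖ ^ 2})
    (fun K => isOpen_lt continuous_const (hcont K))
    (fun v hv => by
      have hv0 : v ≠ 0 := by
        rintro rfl
        simp at hv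
      rw [Set.mem_iUnion]
      by_cases hA : A v = 0
      · exact ⟨0, by simpa using hpos v hA hv0⟩
      · have hA' : 0 < ‖A v‖ ^ 2 := by positivity
        obtain ⟨K, hK⟩ := exists_nat_gt (-(H v v) / ‖A v‖ ^ 2)
        refine ⟨K, ?_⟩
        rw [div_lt_iff₀ hA'] at hK
        simp only [Set.mem_ofPred_eq]
        linarith)
    (directed_of_isDirected_le fun i j hij v hv => by
      simp only [Set.mem_ofPred_eq] at hv ⊢
      refine hv.trans_le ?_
      gcongr)
  have hδ : ∃ δ > 0, ∀ v ∈ Metric.sphere (0 : E) 1, δ ≤ H v v + K * ‖A v‖ ^ 2 := by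
    rcases (Metric.sphere (0 : E) 1).eq_empty_or_nonempty with h | h
    · exact ⟨1, one_pos, by simp [h]⟩
    · obtain ⟨v, hv, hmin⟩ := hS.exists_isMinOn h (hcont K).continuousOn
      exact ⟨_, hK hv, fun w hw => hmin hw⟩
  obtain ⟨δ, hδ, hle⟩ := hδ
  refine ⟨K, δ, hδ, fun v => ?_⟩
  rcases eq_or_ne v 0 with rfl | hv
  · simp
  have hn : 0 < ‖v‖ := norm_pos_iff.2 hv
  have h := hle (‖v‖⁻¹ • v) (by simp [norm_smul, hn.ne'])
  simp only [map_smul, smul_apply, smul_eq_mul, norm_smul, norm_inv, norm_norm] at h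
  have h' := mul_le_mul_of_nonneg_right h (sq_nonneg ‖v‖)
  convert! h' using 1
  field_simp

/-- Exact penalization: if the second-order term `H` is positive definite on the kernel of the
derivative of `G`, then adding any positive multiple of `‖G‖` makes `x` a local minimizer. -/
theorem eventually_le_add_mul_norm [NormedSpace ℝ E] [NormedSpace ℝ F] [FiniteDimensional ℝ E]
    {L : E → ℝ} {G : E → F} {A : E →L[ℝ] F} {x : E} (H : E →L[ℝ] E →L[ℝ] ℝ)
    (hL : ∀ ε > 0, ∀ᶠ y in 𝓝 x, |L y - L x - 2⁻¹ * H (y - x) (y - x)| ≤ ε * ‖y - x‖ ^ 2)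
    (hG : HasFDerivAt G A x) (hGx : G x = 0) (hpos : ∀ v, A v = 0 → v ≠ 0 → 0 < H v v)
    {c : ℝ} (hc : 0 < c) : ∀ᶠ y in 𝓝 x, L x ≤ L y + c * ‖G y‖ := by
  obtain ⟨K, δ, hδ, hK⟩ := H.exists_mul_norm_sq_le A hpos
  obtain ⟨η, hη, hηK⟩ : ∃ η > 0, K * η ^ 2 ≤ δ / 4 := by
    have ht : Tendsto (fun η : ℝ => K * η ^ 2) (𝓝[>] 0) (𝓝 0) :=
      tendsto_nhdsWithin_of_tendsto_nhds (by
        have : Continuous fun η : ℝ => K * η ^ 2 := by fun_prop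
        simpa using this.tendsto 0)
    exact (eventually_mem_nhdsWithin.and (ht.eventually_le_const (by positivity))).exists
  have hsmall : ∀ᶠ y in 𝓝 x, K * ‖G y‖ ≤ c := by
    have ht : Tendsto (fun y => K * ‖G y‖) (𝓝 x) (𝓝 0) := by
      simpa [hGx] using hG.continuousAt.tendsto.norm.const_mul (K : ℝ)
    exact ht.eventually_le_const hc
  filter_upwards [hL (δ / 4) (by positivity), (hasFDerivAt_iff_isLittleO.1 hG).def hη, hsmall]
    with y h1 h2 h3
  rw [hGx, sub_zero] at h2
  have hA : ‖A (y - x)‖ ≤ ‖G y‖ + η * ‖y - x‖ := by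
    have := norm_sub_norm_le (A (y - x)) (G y)
    rw [norm_sub_rev] at this
    linarith
  have hA2 : ‖A (y - x)‖ ^ 2 ≤ 2 * ‖G y‖ ^ 2 + 2 * (η ^ 2 * ‖y - x‖ ^ 2) := by
    have := pow_le_pow_left₀ (norm_nonneg _) hA 2
    nlinarith [sq_nonneg (‖G y‖ - η * ‖y - x‖)]
  have hKA := mul_le_mul_of_nonneg_left hA2 (Nat.cast_nonneg (α := ℝ) K)
  have hKη := mul_le_mul_of_nonneg_right hηK (sq_nonneg ‖y - x‖)
  have hKG := mul_le_mul_of_nonneg_right h3 (norm_nonneg (G y))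
  have hH := hK (y - x)
  have hl := (abs_le.1 h1).1
  nlinarith

/-- Second-order necessary condition along a curve. -/
theorem nonneg_of_eventually_le_curve [NormedSpace ℝ E] {L : E → ℝ} {x ξ : E}
    (H : E →L[ℝ] E →L[ℝ] ℝ)
    (hL : ∀ ε > 0, ∀ᶠ y in 𝓝 x, |L y - L x - 2⁻¹ * H (y - x) (y - x)| ≤ ε * ‖y - x‖ ^ 2)
    {c : ℝ → E} (hc0 : c 0 = x) (hc : HasDerivAt c ξ 0) (hmin : ∀ᶠ t in 𝓝 0, L x ≤ L (c t)) :
    0 ≤ H ξ ξ := by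
  have hct : Tendsto c (𝓝 0) (𝓝 x) := by simpa [hc0] using hc.continuousAt.tendsto
  have hslope : Tendsto (fun t : ℝ => t⁻¹ • (c t - x)) (𝓝[≠] 0) (𝓝 ξ) := by
    simpa [hc0] using hc.tendsto_slope_zero
  have key : ∀ ε > 0, 0 ≤ 2⁻¹ * H ξ ξ + ε * ‖ξ‖ ^ 2 := fun ε hε => by
    have hcont : Continuous fun v => 2⁻¹ * H v v + ε * ‖v‖ ^ 2 := by fun_prop
    refine ge_of_tendsto ((hcont.tendsto ξ).comp hslope) ?_
    filter_upwards [nhdsWithin_le_nhds (hct.eventually (hL ε hε)), nhdsWithin_le_nhds hmin]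
      with t h1 h2
    have h3 : 0 ≤ 2⁻¹ * H (c t - x) (c t - x) + ε * ‖c t - x‖ ^ 2 := by
      linarith [(abs_le.1 h1).2]
    have h4 := mul_nonneg (sq_nonneg t⁻¹) h3
    simp only [Function.comp_apply, map_smul, smul_apply, smul_eq_mul,
      norm_smul, Real.norm_eq_abs, mul_pow, sq_abs]
    linarith
  have hlim : Tendsto (fun ε : ℝ => 2⁻¹ * H ξ ξ + ε * ‖ξ‖ ^ 2) (𝓝[>] 0) (𝓝 (2⁻¹ * H ξ ξ)) := by
    have : Continuous fun ε : ℝ => 2⁻¹ * H ξ ξ + ε * ‖ξ‖ ^ 2 := by fun_prop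
    exact tendsto_nhdsWithin_of_tendsto_nhds (by simpa using this.tendsto 0)
  have := ge_of_tendsto hlim (by filter_upwards [self_mem_nhdsWithin] with ε hε using key ε hε)
  linarith

/-- First-order necessary condition along a one-sided curve. -/
theorem HasDerivAt.nonneg_of_eventually_le_right {g : ℝ → ℝ} {g' a : ℝ} (hg : HasDerivAt g g' a)
    (hmin : ∀ᶠ t in 𝓝[>] a, g a ≤ g t) : 0 ≤ g' := by
  have hslope : Tendsto (slope g a) (𝓝[>] a) (𝓝 g') :=
    (hasDerivAt_iff_tendsto_slope.1 hg).mono_left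
      (nhdsWithin_mono a fun t (ht : a < t) => ht.ne')
  refine ge_of_tendsto hslope ?_
  filter_upwards [hmin, self_mem_nhdsWithin] with t h ht
  rw [slope_def_field]
  exact div_nonneg (sub_nonneg.2 h) (sub_nonneg.2 (le_of_lt ht))

/-- A positive semidefinite symmetric form that is nondegenerate on a subspace is positive
definite there. -/
theorem ContinuousLinearMap.pos_of_nonneg_of_nondegenerate [NormedSpace ℝ E]
    (H : E →L[ℝ] E →L[ℝ] ℝ) (hsymm : ∀ v w, H v w = H w v) (T : Submodule ℝ E)
    (hnonneg : ∀ v ∈ T, 0 ≤ H v v) (hnd : ∀ v ∈ T, (∀ w ∈ T, H v w = 0) → v = 0)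
    {v : E} (hv : v ∈ T) (hv0 : v ≠ 0) : 0 < H v v := by
  refine (hnonneg v hv).lt_of_ne' fun h0 => hv0 (hnd v hv fun w hw => ?_)
  have key : ∀ t : ℝ, 0 ≤ 2 * t * H v w + t ^ 2 * H w w := fun t => by
    have h := hnonneg (v + t • w) (T.add_mem hv (T.smul_mem t hw))
    simp only [map_add, map_smul, add_apply, smul_apply, smul_eq_mul, h0, hsymm w v] at h
    linarith
  have hder : HasDerivAt (fun t : ℝ => 2 * t * H v w + t ^ 2 * H w w) (2 * H v w) 0 := by
    have := (((hasDerivAt_id (0 : ℝ)).const_mul 2).mul_const (H v w)).add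
      (((hasDerivAt_id (0 : ℝ)).pow 2).mul_const (H w w))
    simpa using! this
  have hmin : IsLocalMin (fun t : ℝ => 2 * t * H v w + t ^ 2 * H w w) 0 :=
    Eventually.of_forall fun t => by simpa using key t
  linarith [hmin.hasDerivAt_eq_zero hder]

end Auxiliary

/-- Sufficient/characterizing optimality condition for MPCC at a nondegenerate
T-stationary point: it is a local minimizer iff all biactive multipliers are positive
and D²L(x̄) is positive definite on the tangent space (i.e. its T-index vanishes). -/
theorem mpcc_nondegenerate_local_min_iff {n m : ℕ}
    (f : EuclideanSpace ℝ (Fin n) → ℝ) (F1 F2 : Fin m → EuclideanSpace ℝ (Fin n) → ℝ)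
    (hf : ContDiff ℝ 2 f) (hF1 : ∀ i, ContDiff ℝ 2 (F1 i)) (hF2 : ∀ i, ContDiff ℝ 2 (F2 i))
    (x : EuclideanSpace ℝ (Fin n))
    (hbi : ∀ i, F1 i x = 0 ∧ F2 i x = 0)
    (hLICQ : LinearIndependent ℝ
      (Sum.elim (fun i => gradient (F1 i) x) (fun i => gradient (F2 i) x)))
    (l1 l2 : Fin m → ℝ)
    (hT : gradient f x = ∑ i, (l1 i • gradient (F1 i) x + l2 i • gradient (F2 i) x))
    (hND2 : ∀ i, 0 < l1 i * l2 i)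
    (hND3 : ∀ ξ ∈ tangentSpace F1 F2 x,
      (∀ η ∈ tangentSpace F1 F2 x, hessian (lagrangian f F1 F2 l1 l2) x ξ η = 0) → ξ = 0) :
    IsLocalMinOn f {y | ∀ i, F1 i y * F2 i y = 0 ∧ 0 ≤ F1 i y ∧ 0 ≤ F2 i y} x ↔
      ((∀ i, 0 < l1 i ∧ 0 < l2 i) ∧
       ∀ ξ ∈ tangentSpace F1 F2 x, ξ ≠ 0 →
         0 < hessian (lagrangian f F1 F2 l1 l2) x ξ ξ) := by
  classical
  set S : Set (EuclideanSpace ℝ (Fin n)) :=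
    {y | ∀ i, F1 i y * F2 i y = 0 ∧ 0 ≤ F1 i y ∧ 0 ≤ F2 i y}
  set L := lagrangian f F1 F2 l1 l2 with hLdef
  let G : EuclideanSpace ℝ (Fin n) → Fin m ⊕ Fin m → ℝ := fun y =>
    Sum.elim (fun i => F1 i y) (fun i => F2 i y)
  let A : EuclideanSpace ℝ (Fin n) →L[ℝ] (Fin m ⊕ Fin m → ℝ) :=
    ContinuousLinearMap.pi
      (Sum.elim (fun i => fderiv ℝ (F1 i) x) (fun i => fderiv ℝ (F2 i) x))
  have hA1 : ∀ v i, A v (Sum.inl i) = fderiv ℝ (F1 i) x v := fun v i => rfl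
  have hA2 : ∀ v i, A v (Sum.inr i) = fderiv ℝ (F2 i) x v := fun v i => rfl
  have hG : HasStrictFDerivAt G A x := by
    rw [hasStrictFDerivAt_pi']
    rintro (i | i)
    · exact (hF1 i).contDiffAt.hasStrictFDerivAt (by norm_num)
    · exact (hF2 i).contDiffAt.hasStrictFDerivAt (by norm_num)
  have hGx : G x = 0 := by
    ext (i | i)
    · exact (hbi i).1
    · exact (hbi i).2
  have hA : Function.Surjective A := fun w => by
    obtain ⟨ξ, hξ⟩ := hLICQ.exists_inner_eq w
    refine ⟨ξ, ?_⟩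
    ext (i | i)
    · simpa [hA1, inner_gradient_left] using hξ (Sum.inl i)
    · simpa [hA2, inner_gradient_left] using hξ (Sum.inr i)
  have hT_iff : ∀ v, v ∈ tangentSpace F1 F2 x ↔ A v = 0 := fun v => by
    simp [tangentSpace, inner_gradient_left, funext_iff, hA1, hA2, forall_and]
  have hfd : ∀ v, fderiv ℝ f x v =
      ∑ i, (l1 i * fderiv ℝ (F1 i) x v + l2 i * fderiv ℝ (F2 i) x v) := fun v => by
    rw [← inner_gradient_left, hT, sum_inner]
    simp [inner_add_left, real_inner_smul_left, inner_gradient_left]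
  have hLC : ContDiff ℝ 2 L := hf.sub (ContDiff.sum fun i _ =>
    (contDiff_const.mul (hF1 i)).add (contDiff_const.mul (hF2 i)))
  have hLd : fderiv ℝ L x = 0 := by
    have h : HasFDerivAt L (fderiv ℝ f x -
        ∑ i, (l1 i • fderiv ℝ (F1 i) x + l2 i • fderiv ℝ (F2 i) x)) x :=
      (hf.differentiable (by norm_num) x).hasFDerivAt.sub (HasFDerivAt.fun_sum fun i _ =>
        (((hF1 i).differentiable (by norm_num) x).hasFDerivAt.const_mul (l1 i)).add
          (((hF2 i).differentiable (by norm_num) x).hasFDerivAt.const_mul (l2 i)))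
    rw [h.fderiv]
    ext v
    simp [hfd]
  have hTaylor := fun ε (hε : 0 < ε) => hLC.eventually_abs_sub_le_of_fderiv_eq_zero hLd hε
  have hLf : ∀ y, f y = L y + ∑ i, (l1 i * F1 i y + l2 i * F2 i y) := fun y => by
    simp [hLdef, lagrangian]
  have hLx : f x = L x := by simp [hLf, hbi]
  constructor
  · intro hmin
    have hmin' : ∀ᶠ y in 𝓝 x, y ∈ S → f x ≤ f y := eventually_nhdsWithin_iff.1 hmin
    -- each multiplier is the derivative of `f` along a feasible curve moving one constraint only
    have hfirst : ∀ j : Fin m ⊕ Fin m, 0 ≤ Sum.elim l1 l2 j := fun j => by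
      obtain ⟨ξ, hξ⟩ := hA (Pi.single j 1)
      obtain ⟨c, hc0, hc, hGc⟩ := hG.exists_curve hA ξ
      have hct : Tendsto c (𝓝 0) (𝓝 x) := by simpa [hc0] using hc.continuousAt.tendsto
      have hder : HasDerivAt (fun t => f (c t)) (Sum.elim l1 l2 j) 0 := by
        have hfx : HasFDerivAt f (fderiv ℝ f x) (c 0) := by
          rw [hc0]
          exact (hf.differentiable (by norm_num) x).hasFDerivAt
        convert! hfx.comp_hasDerivAt (0 : ℝ) hc using 1
        rw [hfd]
        simp only [← hA1, ← hA2, hξ]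
        rcases j with j | j <;> simp [Pi.single_apply]
      refine hder.nonneg_of_eventually_le_right ?_
      filter_upwards [nhdsWithin_le_nhds (hct.eventually hmin'), nhdsWithin_le_nhds hGc,
        self_mem_nhdsWithin] with t h1 h2 h3
      have ht : 0 ≤ t := le_of_lt h3
      rw [hc0]
      refine h1 fun i => ?_
      rw [hGx, zero_add, hξ] at h2
      have e1 : F1 i (c t) = t * (Pi.single j 1 : Fin m ⊕ Fin m → ℝ) (Sum.inl i) :=
        congrFun h2 (Sum.inl i)
      have e2 : F2 i (c t) = t * (Pi.single j 1 : Fin m ⊕ Fin m → ℝ) (Sum.inr i) :=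
        congrFun h2 (Sum.inr i)
      rw [e1, e2]
      rcases j with j | j <;> simp only [Pi.single_apply, Sum.inl.injEq, Sum.inr.injEq,
        reduceCtorEq, if_false] <;> split_ifs <;> simp [ht]
    refine ⟨fun i => ?_, fun ξ hξ hξ0 => ?_⟩
    · have h1 : 0 ≤ l1 i := hfirst (Sum.inl i)
      have h2 : 0 ≤ l2 i := hfirst (Sum.inr i)
      exact ⟨h1.lt_of_ne' (left_ne_zero_of_mul (hND2 i).ne'),
        h2.lt_of_ne' (right_ne_zero_of_mul (hND2 i).ne')⟩
    · refine (fderiv ℝ (fderiv ℝ L) x).pos_of_nonneg_of_nondegenerate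
        (hLC.contDiffAt.isSymmSndFDerivAt (by simp)) (LinearMap.ker A.toLinearMap)
        (fun v hv => ?_)
        (fun v hv h => hND3 v ((hT_iff v).2 hv) fun w hw => h w ((hT_iff w).1 hw))
        ((hT_iff ξ).1 hξ) hξ0
      obtain ⟨c, hc0, hc, hGc⟩ := hG.exists_curve hA v
      have hct : Tendsto c (𝓝 0) (𝓝 x) := by simpa [hc0] using hc.continuousAt.tendsto
      refine nonneg_of_eventually_le_curve _ hTaylor hc0 hc ?_
      filter_upwards [hct.eventually hmin', hGc] with t h1 h2
      have hAv : A v = 0 := hv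
      rw [hGx, hAv, smul_zero, zero_add] at h2
      have e1 : ∀ i, F1 i (c t) = 0 := fun i => congrFun h2 (Sum.inl i)
      have e2 : ∀ i, F2 i (c t) = 0 := fun i => congrFun h2 (Sum.inr i)
      have := h1 fun i => by simp [e1, e2]
      simpa [hLx, hLf (c t), e1, e2] using this
  · rintro ⟨hl, hpos⟩
    obtain ⟨c, hc, hcl⟩ : ∃ c > 0, ∀ i, c ≤ l1 i ∧ c ≤ l2 i := by
      have h : ∀ᶠ c in 𝓝[>] (0 : ℝ), ∀ i, c ≤ l1 i ∧ c ≤ l2 i :=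
        eventually_all.2 fun i => nhdsWithin_le_nhds
          ((eventually_le_nhds (hl i).1).and (eventually_le_nhds (hl i).2))
      exact (eventually_mem_nhdsWithin.and h).exists
    have hev := eventually_le_add_mul_norm _ hTaylor hG.hasFDerivAt hGx
      (fun v hv => hpos v ((hT_iff v).2 hv)) hc
    refine eventually_nhdsWithin_iff.2 ?_
    filter_upwards [hev] with y hy hyS
    have hterm : ∀ i, 0 ≤ l1 i * F1 i y ∧ 0 ≤ l2 i * F2 i y := fun i =>
      ⟨mul_nonneg (hl i).1.le (hyS i).2.1, mul_nonneg (hl i).2.le (hyS i).2.2⟩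
    have hsum := fun i => Finset.single_le_sum
      (f := fun i => l1 i * F1 i y + l2 i * F2 i y)
      (fun i _ => add_nonneg (hterm i).1 (hterm i).2) (Finset.mem_univ i)
    have hnorm : c * ‖G y‖ ≤ ∑ i, (l1 i * F1 i y + l2 i * F2 i y) := by
      rw [mul_comm, ← le_div_iff₀ hc, pi_norm_le_iff_of_nonneg
        (div_nonneg (Finset.sum_nonneg fun i _ => add_nonneg (hterm i).1 (hterm i).2) hc.le)]
      rintro (i | i) <;> rw [le_div_iff₀ hc, mul_comm]
      · rw [show ‖G y (Sum.inl i)‖ = F1 i y from Real.norm_of_nonneg (hyS i).2.1]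
        have := mul_le_mul_of_nonneg_right (hcl i).1 (hyS i).2.1
        linarith [hsum i, (hterm i).2]
      · rw [show ‖G y (Sum.inr i)‖ = F2 i y from Real.norm_of_nonneg (hyS i).2.2]
        have := mul_le_mul_of_nonneg_right (hcl i).2 (hyS i).2.2
        linarith [hsum i, (hterm i).1]
    rw [hLx, hLf y]
    linarith
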